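/- Let u, b : ℝ³ → ℝ³ be smooth, divergence-free, and 1-periodic in x₃. If either (u^θ and b^θ are axisymmetric) or (u^r and b^r are axisymmetric), then there is a constant C > 0, independent of R, such that for all R ≥ 2 one has ‖u^r‖_{L²(O_R)} ≤ C ‖∂_{x₃} u^r‖_{L²(O_R)} and ‖b^r‖_{L²(O_R)} ≤ C ‖∂_{x₃} b^r‖_{L²(O_R)}. -/

import Mathlib

open MeasureTheory

noncomputable section

/-- Points of `ℝ³`. -/
abbrev V3 : Type := Fin 3 → ℝ

/-- Partial derivative `∂ᵢ f`. -/
def pd (i : Fin 3) (f : V3 → ℝ) (x : V3) : ℝ := fderiv ℝ f x (Pi.single i 1)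

/-- Componentwise Laplacian. -/
def lap (f : V3 → ℝ) (x : V3) : ℝ := ∑ i, pd i (pd i f) x

/-- Cross product in `ℝ³`. -/
def cross3 (a c : V3) : V3 :=
  ![a 1 * c 2 - a 2 * c 1, a 2 * c 0 - a 0 * c 2, a 0 * c 1 - a 1 * c 0]

/-- Curl of a vector field. -/
def curl (b : V3 → V3) (x : V3) : V3 :=
  ![pd 1 (fun y => b y 2) x - pd 2 (fun y => b y 1) x,
    pd 2 (fun y => b y 0) x - pd 0 (fun y => b y 2) x,
    pd 0 (fun y => b y 1) x - pd 1 (fun y => b y 0) x]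

/-- Euclidean dot product in `ℝ³`. -/
def dot3 (a c : V3) : ℝ := ∑ i, a i * c i

/-- `|x'| = √(x₁² + x₂²)`. -/
def nr (x : V3) : ℝ := Real.sqrt ((x 0) ^ 2 + (x 1) ^ 2)

/-- The slab `ℝ² × [0,1]`. -/
def slab : Set V3 := {x | 0 ≤ x 2 ∧ x 2 ≤ 1}

/-- The region `{|x'| ≤ R} × [0,1]`. -/
def cylSet (R : ℝ) : Set V3 := {x | (0 ≤ x 2 ∧ x 2 ≤ 1) ∧ nr x ≤ R}

/-- The annular region `O_R = {R-1 ≤ |x'| ≤ R} × [0,1]`. -/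
def OR (R : ℝ) : Set V3 := {x | (0 ≤ x 2 ∧ x 2 ≤ 1) ∧ R - 1 ≤ nr x ∧ nr x ≤ R}

/-- The radial cut-off function `φ_R`. -/
def phiR (R : ℝ) (x : V3) : ℝ := min 1 (max 0 (R - nr x))

/-- `|∇u|² = Σ_{i,j} |∂ᵢ uʲ|²`. -/
def gradSq (u : V3 → V3) (x : V3) : ℝ := ∑ i, ∑ j, (pd i (fun y => u y j) x) ^ 2

/-- The `L²` norm of a scalar function on a set. -/
def l2 (f : V3 → ℝ) (S : Set V3) : ℝ := Real.sqrt (∫ x in S, (f x) ^ 2)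

/-- The radial component `u^r` as a function of `x`. -/
def ur (u : V3 → V3) (x : V3) : ℝ := (x 0 * u x 0 + x 1 * u x 1) / nr x

/-- The point with cylindrical coordinates `(r, θ, z)`. -/
def cylPt (r θ z : ℝ) : V3 := ![r * Real.cos θ, r * Real.sin θ, z]

/-- The radial component `u^r` in cylindrical coordinates. -/
def compR (u : V3 → V3) (r θ z : ℝ) : ℝ :=
  Real.cos θ * u (cylPt r θ z) 0 + Real.sin θ * u (cylPt r θ z) 1

/-- The swirl component `u^θ` in cylindrical coordinates. -/
def compTheta (u : V3 → V3) (r θ z : ℝ) : ℝ :=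
  -Real.sin θ * u (cylPt r θ z) 0 + Real.cos θ * u (cylPt r θ z) 1

/-- A cylindrical component is axisymmetric if it is independent of `θ`. -/
def AxiSym (f : ℝ → ℝ → ℝ → ℝ) : Prop := ∀ r θ₁ θ₂ z, f r θ₁ z = f r θ₂ z

/-- `1`-periodicity in the `x₃` variable. -/
def PeriodicZ (u : V3 → V3) : Prop := ∀ x : V3, u ![x 0, x 1, x 2 + 1] = u x

/-- Divergence-free vector field. -/
def DivFree (u : V3 → V3) : Prop := ∀ x, ∑ i, pd i (fun y => u y i) x = 0

/-- Boundedness of a vector field. -/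
def Bounded3 (u : V3 → V3) : Prop := ∃ M, ∀ x, ‖u x‖ ≤ M

/-- The stationary MHD (`δ = 0`) / Hall–MHD (`δ = 1`) system:
`(u·∇)u + ∇p − (b·∇)b − Δu = 0`,
`(u·∇)b − (b·∇)u − Δb = δ ∇×((∇×b)×b)`, `div u = div b = 0`. -/
def IsMHD (δ : ℝ) (u b : V3 → V3) (p : V3 → ℝ) : Prop :=
  (∀ x i, (∑ j, u x j * pd j (fun y => u y i) x) + pd i p x
      - (∑ j, b x j * pd j (fun y => b y i) x) - lap (fun y => u y i) x = 0) ∧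
  (∀ x i, (∑ j, u x j * pd j (fun y => b y i) x)
      - (∑ j, b x j * pd j (fun y => u y i) x) - lap (fun y => b y i) x
      = δ * curl (fun y => cross3 (curl b y) (b y)) x i) ∧
  DivFree u ∧ DivFree b

/-- Growth of the local Dirichlet integral: `∫_{{|x'|≤R}×[0,1]} |∇u|²+|∇b|² ≤ C R^α`. -/
def DirichletGrowth (u b : V3 → V3) : Prop :=
  ∃ C > (0:ℝ), ∃ α > (0:ℝ), ∀ R > (1:ℝ),
    (∫ x in cylSet R, (gradSq u x + gradSq b x)) ≤ C * R ^ α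

/-- Radial derivative `∂_r f = (x'/|x'|)·(∂₁f, ∂₂f)`. -/
def radD (f : V3 → ℝ) (x : V3) : ℝ := (x 0 / nr x) * pd 0 f x + (x 1 / nr x) * pd 1 f x

/-- The unit radial vector `(x'/|x'|, 0)`. -/
def er3 (x : V3) : V3 := ![x 0 / nr x, x 1 / nr x, 0]

/-- Squared Euclidean length of a vector of `ℝ³`. -/
def sq3 (v : V3) : ℝ := ∑ i, (v i) ^ 2

/-- The Poincaré inequality on `[0,1]` for functions of mean zero. -/
lemma integral_sq_le_integral_deriv_sq {f g : ℝ → ℝ} (hfg : ∀ t, HasDerivAt f (g t) t)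
    (hg : Continuous g) (hf0 : ∫ t in (0:ℝ)..1, f t = 0) :
    ∫ t in (0:ℝ)..1, (f t) ^ 2 ≤ ∫ t in (0:ℝ)..1, (g t) ^ 2 := by
  have hf : Continuous f := continuous_iff_continuousAt.2 fun t => (hfg t).continuousAt
  obtain ⟨c, hc, hfc⟩ : ∃ c ∈ Set.Ioo (0:ℝ) 1, f c = 0 := by
    have hF : ∀ x, HasDerivAt (fun x => ∫ t in (0:ℝ)..x, f t) (f x) x := fun x =>
      intervalIntegral.integral_hasDerivAt_right (hf.intervalIntegrable _ _)
        hf.stronglyMeasurable.stronglyMeasurableAtFilter hf.continuousAt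
    exact exists_hasDerivAt_eq_zero (f' := f) one_pos
      (fun x _ => (hF x).continuousAt.continuousWithinAt) (by simp [hf0]) (fun x _ => hF x)
  set A := ∫ t in (0:ℝ)..1, |g t| with hA
  have hbound : ∀ t ∈ Set.Icc (0:ℝ) 1, (f t) ^ 2 ≤ A ^ 2 := by
    intro t ht
    have h1 : ∫ s in c..t, g s = f t := by
      rw [intervalIntegral.integral_eq_sub_of_hasDerivAt (fun s _ => hfg s)
        (hg.intervalIntegrable _ _), hfc, sub_zero]
    have h2 : |f t| ≤ A := by
      rw [← h1, hA, intervalIntegral.integral_of_le zero_le_one]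
      refine (intervalIntegral.norm_integral_le_integral_norm_uIoc
        (f := g) (μ := volume) (a := c) (b := t)).trans ?_
      refine setIntegral_mono_set ?_ (Filter.Eventually.of_forall fun x => norm_nonneg _) ?_
      · exact (hg.abs.intervalIntegrable 0 1).1
      · exact LE.le.eventuallyLE (Set.Ioc_subset_Ioc (le_min hc.1.le ht.1)
          (max_le hc.2.le ht.2) : Set.uIoc c t ⊆ Set.Ioc 0 1)
    exact sq_le_sq' (by linarith [neg_abs_le (f t)]) ((le_abs_self _).trans h2)
  have h3 : ∫ t in (0:ℝ)..1, (f t) ^ 2 ≤ A ^ 2 := by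
    have := intervalIntegral.integral_mono_on (μ := volume) zero_le_one ((hf.pow 2).intervalIntegrable 0 1)
      (continuous_const.intervalIntegrable 0 1) hbound
    simpa using this
  have h4 : 0 ≤ ∫ t in (0:ℝ)..1, (|g t| - A) ^ 2 :=
    intervalIntegral.integral_nonneg zero_le_one fun t _ => sq_nonneg _
  have h5 : ∫ t in (0:ℝ)..1, (|g t| - A) ^ 2
      = (∫ t in (0:ℝ)..1, (g t) ^ 2) - 2 * A * A + A ^ 2 := by
    have : ∀ t, (|g t| - A) ^ 2 = (g t) ^ 2 - 2 * A * |g t| + A ^ 2 := fun t => by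
      rw [sub_sq, sq_abs]; ring
    simp only [this]
    rw [intervalIntegral.integral_add (Continuous.intervalIntegrable (by fun_prop) _ _)
      (Continuous.intervalIntegrable (by fun_prop) _ _),
      intervalIntegral.integral_sub (Continuous.intervalIntegrable (by fun_prop) _ _)
      (Continuous.intervalIntegrable (by fun_prop) _ _), intervalIntegral.integral_const_mul]
    simp [hA]
  nlinarith

lemma fderiv_apply_eq_pd (f : V3 → ℝ) (x v : V3) :
    fderiv ℝ f x v = v 0 * pd 0 f x + v 1 * pd 1 f x + v 2 * pd 2 f x := by
  conv_lhs => rw [pi_eq_sum_univ' v]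
  simp [Fin.sum_univ_three, pd]

lemma hasDerivAt_comp_pd {f : V3 → ℝ} {γ : ℝ → V3} {v : V3} {t : ℝ}
    (hf : DifferentiableAt ℝ f (γ t)) (hγ : HasDerivAt γ v t) :
    HasDerivAt (fun s => f (γ s))
      (v 0 * pd 0 f (γ t) + v 1 * pd 1 f (γ t) + v 2 * pd 2 f (γ t)) t := by
  rw [← fderiv_apply_eq_pd]
  exact hf.hasFDerivAt.comp_hasDerivAt t hγ

lemma hasDerivAt_vec3 {f g h : ℝ → ℝ} {a b c t : ℝ} (hf : HasDerivAt f a t)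
    (hg : HasDerivAt g b t) (hh : HasDerivAt h c t) :
    HasDerivAt (fun s => (![f s, g s, h s] : V3)) ![a, b, c] t := by
  rw [hasDerivAt_pi]
  intro i
  fin_cases i
  exacts [hf, hg, hh]

/-- The derivative `∂ᵣ (r uʳ)` in cylindrical coordinates. -/
def radialFluxDeriv (u : V3 → V3) (r θ z : ℝ) : ℝ :=
  compR u r θ z + r *
    (Real.cos θ * (Real.cos θ * pd 0 (fun y => u y 0) (cylPt r θ z)
        + Real.sin θ * pd 1 (fun y => u y 0) (cylPt r θ z))
      + Real.sin θ * (Real.cos θ * pd 0 (fun y => u y 1) (cylPt r θ z)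
        + Real.sin θ * pd 1 (fun y => u y 1) (cylPt r θ z)))

section Field

variable {u : V3 → V3} (hu : ContDiff ℝ (⊤ : ℕ∞) u)

include hu

lemma contDiff_component (i : Fin 3) : ContDiff ℝ (⊤ : ℕ∞) fun y => u y i :=
  contDiff_pi.1 hu i

lemma differentiable_component (i : Fin 3) : Differentiable ℝ fun y => u y i :=
  (contDiff_component hu i).differentiable (by simp)

lemma continuous_pd_component (i j : Fin 3) : Continuous (pd j fun y => u y i) :=
  ((contDiff_component hu i).continuous_fderiv (by simp)).clm_apply continuous_const

lemma hasDerivAt_radialFlux (r θ z : ℝ) :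
    HasDerivAt (fun r => r * compR u r θ z) (radialFluxDeriv u r θ z) r := by
  have hγ : HasDerivAt (fun s => cylPt s θ z) ![Real.cos θ, Real.sin θ, 0] r := by
    refine hasDerivAt_vec3 ?_ ?_ (hasDerivAt_const r z)
    · simpa using (hasDerivAt_id r).mul_const (Real.cos θ)
    · simpa using (hasDerivAt_id r).mul_const (Real.sin θ)
  have h0 := hasDerivAt_comp_pd (differentiable_component hu 0 _) hγ
  have h1 := hasDerivAt_comp_pd (differentiable_component hu 1 _) hγ
  refine ((hasDerivAt_id r).mul
    ((h0.const_mul (Real.cos θ)).add (h1.const_mul (Real.sin θ)))).congr_deriv ?_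
  simp [radialFluxDeriv, compR]

lemma hasDerivAt_compTheta (hud : DivFree u) (r θ z : ℝ) :
    HasDerivAt (fun θ => compTheta u r θ z)
      (-radialFluxDeriv u r θ z - r * pd 2 (fun y => u y 2) (cylPt r θ z)) θ := by
  have hγ : HasDerivAt (fun s => cylPt r s z) ![r * -Real.sin θ, r * Real.cos θ, 0] θ :=
    hasDerivAt_vec3 ((Real.hasDerivAt_cos θ).const_mul r) ((Real.hasDerivAt_sin θ).const_mul r)
      (hasDerivAt_const θ z)
  have h0 := hasDerivAt_comp_pd (differentiable_component hu 0 _) hγ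
  have h1 := hasDerivAt_comp_pd (differentiable_component hu 1 _) hγ
  refine (((Real.hasDerivAt_sin θ).neg.mul h0).add
    ((Real.hasDerivAt_cos θ).mul h1)).congr_deriv ?_
  have hdiv := hud (cylPt r θ z)
  rw [Fin.sum_univ_three] at hdiv
  simp only [radialFluxDeriv, compR, Matrix.cons_val_zero, Matrix.cons_val_one,
    Matrix.cons_val, Pi.neg_apply]
  linear_combination r * hdiv
    + r * (pd 0 (fun y => u y 0) (cylPt r θ z) + pd 1 (fun y => u y 1) (cylPt r θ z)) *
      Real.sin_sq_add_cos_sq θ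

omit hu in
lemma continuous_cylPt : Continuous fun p : ℝ × ℝ × ℝ => cylPt p.1 p.2.1 p.2.2 := by
  unfold cylPt
  fun_prop

lemma continuous_radialFluxDeriv :
    Continuous fun p : ℝ × ℝ × ℝ => radialFluxDeriv u p.1 p.2.1 p.2.2 := by
  have hc := continuous_cylPt
  have h (i j : Fin 3) := (continuous_pd_component hu i j).comp hc
  have h' (i : Fin 3) := (differentiable_component hu i).continuous.comp hc
  have hcos : Continuous fun p : ℝ × ℝ × ℝ => Real.cos p.2.1 := by fun_prop
  have hsin : Continuous fun p : ℝ × ℝ × ℝ => Real.sin p.2.1 := by fun_prop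
  exact ((hcos.mul (h' 0)).add (hsin.mul (h' 1))).add
    (continuous_fst.mul ((hcos.mul ((hcos.mul (h 0 0)).add (hsin.mul (h 0 1)))).add
      (hsin.mul ((hcos.mul (h 1 0)).add (hsin.mul (h 1 1))))))

lemma integral_pd_two_eq_zero (hup : PeriodicZ u) (r θ : ℝ) :
    ∫ z in (0:ℝ)..1, pd 2 (fun y => u y 2) (cylPt r θ z) = 0 := by
  have hγ (z : ℝ) : HasDerivAt (fun s => cylPt r θ s) ![0, 0, 1] z :=
    hasDerivAt_vec3 (hasDerivAt_const _ _) (hasDerivAt_const _ _) (hasDerivAt_id z)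
  have h (z : ℝ) : HasDerivAt (fun s => u (cylPt r θ s) 2)
      (pd 2 (fun y => u y 2) (cylPt r θ z)) z := by
    simpa using hasDerivAt_comp_pd (differentiable_component hu 2 _) (hγ z)
  rw [intervalIntegral.integral_eq_sub_of_hasDerivAt (fun z _ => h z), sub_eq_zero]
  · have := hup (cylPt r θ 0)
    simp only [cylPt, Matrix.cons_val_zero, Matrix.cons_val_one, Matrix.cons_val,
      zero_add] at this ⊢
    rw [this]
  · exact ((continuous_pd_component hu 2 2).comp
      (continuous_cylPt.comp (by fun_prop : Continuous fun z : ℝ => (r, θ, z)))).intervalIntegrable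
        _ _

omit hu in
lemma intervalIntegral_swap_of_continuous {F : ℝ → ℝ → ℝ} (hF : Continuous F.uncurry)
    (a b c d : ℝ) :
    ∫ x in a..b, ∫ y in c..d, F x y = ∫ y in c..d, ∫ x in a..b, F x y :=
  intervalIntegral_intervalIntegral_swap <|
    (hF.continuousOn.integrableOn_compact (isCompact_uIcc.prod isCompact_uIcc)).mono_set
      (Set.prod_mono Set.uIoc_subset_uIcc Set.uIoc_subset_uIcc)

lemma integral_radialFluxDeriv_of_compTheta (hud : DivFree u) (hup : PeriodicZ u)
    (hax : AxiSym (compTheta u)) (r θ : ℝ) :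
    ∫ z in (0:ℝ)..1, radialFluxDeriv u r θ z = 0 := by
  have h (z : ℝ) : radialFluxDeriv u r θ z = -r * pd 2 (fun y => u y 2) (cylPt r θ z) := by
    have h1 := hasDerivAt_compTheta hu hud r θ z
    have h2 : (fun θ => compTheta u r θ z) = fun _ => compTheta u r 0 z :=
      funext fun θ => hax r θ 0 z
    rw [h2] at h1
    linarith [h1.unique (hasDerivAt_const θ _)]
  simp only [h, intervalIntegral.integral_const_mul, integral_pd_two_eq_zero hu hup, mul_zero]

lemma integral_radialFluxDeriv_of_compR (hud : DivFree u) (hup : PeriodicZ u)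
    (hax : AxiSym (compR u)) (r θ : ℝ) :
    ∫ z in (0:ℝ)..1, radialFluxDeriv u r θ z = 0 := by
  have hpd : Continuous fun p : ℝ × ℝ => pd 2 (fun y => u y 2) (cylPt r p.1 p.2) :=
    (continuous_pd_component hu 2 2).comp
      (continuous_cylPt.comp (by fun_prop : Continuous fun p : ℝ × ℝ => (r, p.1, p.2)))
  have hindep (θ' z : ℝ) : radialFluxDeriv u r θ' z = radialFluxDeriv u r θ z := by
    have h1 := hasDerivAt_radialFlux hu r θ' z
    simp only [hax _ θ' θ] at h1
    exact h1.unique (hasDerivAt_radialFlux hu r θ z)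
  have h (z : ℝ) : 2 * Real.pi * radialFluxDeriv u r θ z
      = -r * ∫ θ' in (0:ℝ)..2 * Real.pi, pd 2 (fun y => u y 2) (cylPt r θ' z) := by
    have hi : IntervalIntegrable (fun θ' => pd 2 (fun y => u y 2) (cylPt r θ' z)) volume 0
        (2 * Real.pi) :=
      (hpd.comp (by fun_prop : Continuous fun s : ℝ => (s, z))).intervalIntegrable _ _
    have h1 := intervalIntegral.integral_eq_sub_of_hasDerivAt
      (fun θ' (_ : θ' ∈ Set.uIcc 0 (2 * Real.pi)) => hasDerivAt_compTheta hu hud r θ' z)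
      (by simp only [hindep _ z]; exact intervalIntegrable_const.sub (hi.const_mul r))
    simp only [hindep _ z] at h1
    rw [intervalIntegral.integral_sub intervalIntegrable_const (hi.const_mul r),
      intervalIntegral.integral_const_mul, intervalIntegral.integral_const] at h1
    have h2 : compTheta u r (2 * Real.pi) z = compTheta u r 0 z := by
      simp [compTheta, cylPt]
    rw [h2, sub_self, smul_eq_mul] at h1
    linarith
  have h3 : 2 * Real.pi * ∫ z in (0:ℝ)..1, radialFluxDeriv u r θ z = 0 := by
    rw [← intervalIntegral.integral_const_mul]
    simp only [h]
    rw [intervalIntegral.integral_const_mul, ← intervalIntegral_swap_of_continuous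
      (F := fun θ' z => pd 2 (fun y => u y 2) (cylPt r θ' z)) hpd]
    simp [integral_pd_two_eq_zero hu hup]
  exact (mul_eq_zero.1 h3).resolve_left (by positivity)

lemma integral_compR_eq_zero (h : ∀ r θ, ∫ z in (0:ℝ)..1, radialFluxDeriv u r θ z = 0)
    {r : ℝ} (hr : r ≠ 0) (θ : ℝ) : ∫ z in (0:ℝ)..1, compR u r θ z = 0 := by
  have hc : Continuous fun p : ℝ × ℝ => radialFluxDeriv u p.1 θ p.2 :=
    Continuous.comp (g := fun p : ℝ × ℝ × ℝ => radialFluxDeriv u p.1 p.2.1 p.2.2)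
      (f := fun p : ℝ × ℝ => (p.1, θ, p.2)) (continuous_radialFluxDeriv hu) (by fun_prop)
  have h1 (z : ℝ) : r * compR u r θ z = ∫ s in (0:ℝ)..r, radialFluxDeriv u s θ z := by
    have hi : IntervalIntegrable (fun s => radialFluxDeriv u s θ z) volume 0 r :=
      (hc.comp (by fun_prop : Continuous fun s : ℝ => (s, z))).intervalIntegrable _ _
    rw [intervalIntegral.integral_eq_sub_of_hasDerivAt (f := fun s => s * compR u s θ z)
      (fun s _ => hasDerivAt_radialFlux hu s θ z) hi, zero_mul, sub_zero]
  have h2 : r * ∫ z in (0:ℝ)..1, compR u r θ z = 0 := by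
    rw [← intervalIntegral.integral_const_mul]
    simp only [h1]
    rw [← intervalIntegral_swap_of_continuous (F := fun s z => radialFluxDeriv u s θ z) hc]
    simp [h]
  exact (mul_eq_zero.1 h2).resolve_left hr

/-- The explicit expression of `∂₃ uʳ` away from the axis. -/
lemma hasDerivAt_ur_and_pd_two_ur {a b z : ℝ} (hn : nr ![a, b, z] ≠ 0) :
    HasDerivAt (fun s => ur u ![a, b, s]) (pd 2 (ur u) ![a, b, z]) z ∧
    pd 2 (ur u) ![a, b, z] = (a * pd 2 (fun y => u y 0) ![a, b, z]
      + b * pd 2 (fun y => u y 1) ![a, b, z]) / nr ![a, b, z] := by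
  have hγ : HasDerivAt (fun s => (![a, b, s] : V3)) ![0, 0, 1] z :=
    hasDerivAt_vec3 (hasDerivAt_const _ _) (hasDerivAt_const _ _) (hasDerivAt_id z)
  have hd : DifferentiableAt ℝ (ur u) ![a, b, z] := by
    have h0 := differentiable_component hu 0
    have h1 := differentiable_component hu 1
    have hsq : (![a, b, z] : V3) 0 ^ 2 + (![a, b, z] : V3) 1 ^ 2 ≠ 0 := fun h =>
      hn (by rw [nr, h, Real.sqrt_zero])
    have hnd : DifferentiableAt ℝ nr ![a, b, z] := by
      unfold nr
      exact DifferentiableAt.sqrt (f := fun x : V3 => x 0 ^ 2 + x 1 ^ 2) (by fun_prop) hsq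
    have hnum : DifferentiableAt ℝ (fun x : V3 => x 0 * u x 0 + x 1 * u x 1) ![a, b, z] := by
      fun_prop
    unfold ur
    simp only [div_eq_mul_inv]
    exact hnum.fun_mul (hnd.fun_inv hn)
  have h : HasDerivAt (fun s => ur u ![a, b, s]) (pd 2 (ur u) ![a, b, z]) z := by
    simpa using hasDerivAt_comp_pd hd hγ
  refine ⟨h, h.unique ?_⟩
  have h0 := hasDerivAt_comp_pd (differentiable_component hu 0 _) hγ
  have h1 := hasDerivAt_comp_pd (differentiable_component hu 1 _) hγ
  simpa [ur, nr] using ((h0.const_mul a).add (h1.const_mul b)).div_const (nr ![a, b, z])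

end Field

lemma ur_cylPt {u : V3 → V3} {r : ℝ} (hr : 0 < r) (θ z : ℝ) :
    ur u (cylPt r θ z) = compR u r θ z := by
  have h : nr (cylPt r θ z) = r := by
    simp only [nr, cylPt, Matrix.cons_val_zero, Matrix.cons_val_one]
    rw [mul_pow, mul_pow, ← mul_add, Real.cos_sq_add_sin_sq, mul_one, Real.sqrt_sq hr.le]
  rw [ur, h, div_eq_iff hr.ne', compR]
  simp only [cylPt, Matrix.cons_val_zero, Matrix.cons_val_one]
  ring

lemma exists_cylPt_eq (a b : ℝ) : ∃ θ, ∀ z, cylPt (nr ![a, b, 0]) θ z = ![a, b, z] := by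
  refine ⟨Complex.arg ⟨a, b⟩, fun z => ?_⟩
  have hn : nr ![a, b, 0] = ‖(⟨a, b⟩ : ℂ)‖ := by
    rw [Complex.norm_eq_sqrt_sq_add_sq]
    simp [nr]
  rw [cylPt, hn, Complex.norm_mul_cos_arg, Complex.norm_mul_sin_arg]

lemma continuous_nr : Continuous nr := by
  unfold nr
  fun_prop

lemma isCompact_OR (R : ℝ) : IsCompact (OR R) := by
  refine (isCompact_Icc (a := (![-R, -R, 0] : V3)) (b := ![R, R, 1])).of_isClosed_subset ?_ ?_
  · exact ((isClosed_le continuous_const (continuous_apply 2)).inter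
      (isClosed_le (continuous_apply 2) continuous_const)).inter
      ((isClosed_le continuous_const continuous_nr).inter
        (isClosed_le continuous_nr continuous_const))
  · rintro x ⟨⟨h0, h1⟩, -, h2⟩
    have hx0 : |x 0| ≤ R := (Real.abs_le_sqrt (by nlinarith [sq_nonneg (x 1)])).trans h2
    have hx1 : |x 1| ≤ R := (Real.abs_le_sqrt (by nlinarith [sq_nonneg (x 0)])).trans h2
    rw [abs_le] at hx0 hx1
    constructor <;> intro i <;> fin_cases i
    exacts [hx0.1, hx1.1, h0, hx0.2, hx1.2, h1]

/-- Fubini's theorem on `O_R`: nonnegativity of all vertical integrals implies nonnegativity of the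
integral. -/
lemma setIntegral_OR_nonneg {h : V3 → ℝ} {R : ℝ} (hh : ContinuousOn h (OR R))
    (hz : ∀ a b : ℝ, R - 1 ≤ nr ![a, b, 0] → 0 ≤ ∫ z in (0:ℝ)..1, h ![a, b, z]) :
    0 ≤ ∫ x in OR R, h x := by
  have he := (volume_preserving_piFinSuccAbove (fun _ : Fin 3 => ℝ) 2).symm
  set e := (MeasurableEquiv.piFinSuccAbove (fun _ : Fin 3 => ℝ) 2).symm with he_def
  have hev (p : ℝ × (Fin 2 → ℝ)) : e p = ![p.2 0, p.2 1, p.1] := by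
    funext i
    fin_cases i <;> rfl
  set A : Set (Fin 2 → ℝ) :=
    {w | R - 1 ≤ nr ![w 0, w 1, 0] ∧ nr ![w 0, w 1, 0] ≤ R} with hA
  have hpre : e ⁻¹' OR R = Set.Icc 0 1 ×ˢ A := by
    ext p
    simp [hev, OR, hA, nr]
  have hAm : MeasurableSet A := by
    have h1 : Continuous fun w : Fin 2 → ℝ => nr ![w 0, w 1, 0] :=
      continuous_nr.comp (by fun_prop)
    exact (measurableSet_le measurable_const h1.measurable).inter
      (measurableSet_le h1.measurable measurable_const)
  have hint : IntegrableOn h (OR R) := hh.integrableOn_compact (isCompact_OR R)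
  have hint' := (he.integrableOn_comp_preimage e.measurableEmbedding).2 hint
  rw [← he.setIntegral_preimage_emb e.measurableEmbedding, hpre, Measure.volume_eq_prod,
    ← Measure.prod_restrict, integral_prod_symm]
  · refine setIntegral_nonneg hAm fun w hw => ?_
    rw [integral_Icc_eq_integral_Ioc, ← intervalIntegral.integral_of_le zero_le_one]
    simpa only [hev] using hz (w 0) (w 1) hw.1
  · rw [Measure.prod_restrict, ← Measure.volume_eq_prod, ← hpre]
    exact hint'

lemma l2_ur_le {u : V3 → V3} (hu : ContDiff ℝ (⊤ : ℕ∞) u)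
    (h : ∀ r θ, ∫ z in (0:ℝ)..1, radialFluxDeriv u r θ z = 0) {R : ℝ} (hR : 2 ≤ R) :
    l2 (ur u) (OR R) ≤ l2 (pd 2 (ur u)) (OR R) := by
  have hn {x : V3} (hx : x ∈ OR R) : nr x ≠ 0 := (by linarith [hx.2.1] : 0 < nr x).ne'
  have hvec (x : V3) : x = ![x 0, x 1, x 2] := by
    funext i
    fin_cases i <;> rfl
  have hc0 := (differentiable_component hu 0).continuous
  have hc1 := (differentiable_component hu 1).continuous
  have hcont : ContinuousOn (ur u) (OR R) := by
    unfold ur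
    exact ContinuousOn.div (by fun_prop) continuous_nr.continuousOn fun x hx => hn hx
  have hcont' : ContinuousOn (pd 2 (ur u)) (OR R) := by
    have hd0 := continuous_pd_component hu 0 2
    have hd1 := continuous_pd_component hu 1 2
    have : ContinuousOn (fun x : V3 => (x 0 * pd 2 (fun y => u y 0) x
        + x 1 * pd 2 (fun y => u y 1) x) / nr x) (OR R) :=
      ContinuousOn.div (((continuous_apply 0).mul hd0).add
        ((continuous_apply 1).mul hd1)).continuousOn continuous_nr.continuousOn fun x hx => hn hx
    refine this.congr fun x hx => ?_
    have hx' := hn hx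
    rw [hvec x] at hx' ⊢
    exact (hasDerivAt_ur_and_pd_two_ur hu hx').2
  refine Real.sqrt_le_sqrt ?_
  rw [← sub_nonneg, ← integral_sub]
  · refine setIntegral_OR_nonneg ((hcont'.pow 2).sub (hcont.pow 2)) fun a b hab => ?_
    have hpos : 0 < nr ![a, b, 0] := by linarith
    have hne (z : ℝ) : nr ![a, b, z] ≠ 0 := by
      simpa [nr] using hpos.ne'
    have hderiv (z : ℝ) := (hasDerivAt_ur_and_pd_two_ur hu (hne z)).1
    have hline : Continuous fun z : ℝ => (![a, b, z] : V3) := by fun_prop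
    have hg : Continuous fun z => pd 2 (ur u) ![a, b, z] := by
      refine Continuous.congr ?_ fun z => (hasDerivAt_ur_and_pd_two_ur hu (hne z)).2.symm
      exact ((((continuous_pd_component hu 0 2).comp hline).const_mul a).add
        (((continuous_pd_component hu 1 2).comp hline).const_mul b)).div
        (continuous_nr.comp hline) hne
    have hf : Continuous fun z => ur u ![a, b, z] :=
      continuous_iff_continuousAt.2 fun z => (hderiv z).continuousAt
    have hmean : ∫ z in (0:ℝ)..1, ur u ![a, b, z] = 0 := by
      obtain ⟨θ, hθ⟩ := exists_cylPt_eq a b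
      have hur (z : ℝ) : ur u ![a, b, z] = compR u (nr ![a, b, 0]) θ z := by
        rw [← hθ z, ur_cylPt hpos]
      simp only [hur]
      exact integral_compR_eq_zero hu h hpos.ne' θ
    rw [intervalIntegral.integral_sub ((hg.fun_pow 2).intervalIntegrable _ _)
      ((hf.fun_pow 2).intervalIntegrable _ _), sub_nonneg]
    exact integral_sq_le_integral_deriv_sq hderiv hg hmean
  · exact (hcont'.pow 2).integrableOn_compact (isCompact_OR R)
  · exact (hcont.pow 2).integrableOn_compact (isCompact_OR R)

/-- Poincaré inequalities for `u^r, b^r` on `O_R` under axisymmetry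
of the swirl or the radial components. -/
theorem poincare_OR (u b : V3 → V3)
    (hu : ContDiff ℝ (⊤ : ℕ∞) u) (hb : ContDiff ℝ (⊤ : ℕ∞) b)
    (hud : DivFree u) (hbd : DivFree b)
    (hup : PeriodicZ u) (hbp : PeriodicZ b)
    (hax : (AxiSym (compTheta u) ∧ AxiSym (compTheta b)) ∨
           (AxiSym (compR u) ∧ AxiSym (compR b))) :
    ∃ C > (0:ℝ), ∀ R ≥ (2:ℝ),
      l2 (ur u) (OR R) ≤ C * l2 (pd 2 (ur u)) (OR R) ∧
      l2 (ur b) (OR R) ≤ C * l2 (pd 2 (ur b)) (OR R) := by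
  obtain ⟨h₁, h₂⟩ : (∀ r θ, ∫ z in (0:ℝ)..1, radialFluxDeriv u r θ z = 0) ∧
      (∀ r θ, ∫ z in (0:ℝ)..1, radialFluxDeriv b r θ z = 0) := by
    rcases hax with ⟨h₁, h₂⟩ | ⟨h₁, h₂⟩
    · exact ⟨integral_radialFluxDeriv_of_compTheta hu hud hup h₁,
        integral_radialFluxDeriv_of_compTheta hb hbd hbp h₂⟩
    · exact ⟨integral_radialFluxDeriv_of_compR hu hud hup h₁,
        integral_radialFluxDeriv_of_compR hb hbd hbp h₂⟩
  refine ⟨1, one_pos, fun R hR => ?_⟩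
  rw [one_mul, one_mul]
  exact ⟨l2_ur_le hu h₁ hR, l2_ur_le hb h₂ hR⟩
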